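/- Let T be a search tree on a finite undirected tree 𝒯 and let ℋ be a connected subgraph of 𝒯. Then there exists a unique search tree T|_ℋ on ℋ such that for every vertex v ∈ V(ℋ), Path_{T|ℋ}(v) = Path_T(v) ∩ V(ℋ), where Path_T(v) denotes the set of vertices on the path in T from the root of T to v, including both endpoints. -/

import Mathlib

open Filter Topology

universe u

variable {V : Type u}

/-- Rooted trees with vertices labelled by elements of `V`. -/
inductive RTree (V : Type u) : Type u where
  | node : V → List (RTree V) → RTree V

namespace RTree

/-- The root of a rooted tree. -/
def root : RTree V → V
  | node r _ => r

/-- The subtrees rooted at the children of the root. -/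
def children : RTree V → List (RTree V)
  | node _ ts => ts

/-- The list of pairs `(v, path from the root to v)` over all vertices `v` of the tree. -/
def pathsFrom : RTree V → List (V × List V)
  | node r ts =>
      (r, [r]) ::
        (ts.attach.map fun t => (t.1.pathsFrom.map fun p => (p.1, r :: p.2))).flatten
  decreasing_by
    simp only [RTree.node.sizeOf_spec]
    have := List.sizeOf_lt_of_mem t.2
    omega

/-- The vertex set of a rooted tree. -/
def vertSet (T : RTree V) : Set V := {v | ∃ p ∈ T.pathsFrom, p.1 = v}

/-- `Path_T(v)`: the set of vertices on the path in `T` from the root to `v`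
(including both endpoints). -/
def pathSet (T : RTree V) (v : V) : Set V := {x | ∃ p ∈ T.pathsFrom, p.1 = v ∧ x ∈ p.2}

/-- The depth of a vertex `v` in `T`; the root has depth 1. -/
noncomputable def depth (T : RTree V) (v : V) : ℕ := (T.pathSet v).ncard

/-- All subtrees of a rooted tree (including the tree itself). -/
def allSubtrees : RTree V → List (RTree V)
  | node r ts => node r ts :: (ts.attach.map fun t => t.1.allSubtrees).flatten
  decreasing_by
    simp only [RTree.node.sizeOf_spec]
    have := List.sizeOf_lt_of_mem t.2
    omega

/-- Two rooted trees are equivalent (represent the same search tree) if they have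
the same root-to-vertex paths. -/
def Equiv (T₁ T₂ : RTree V) : Prop := ∀ v, T₁.pathSet v = T₂.pathSet v

end RTree

/-- `x` and `y` are joined by a walk of `G` staying inside `s`. -/
def ReachIn (G : SimpleGraph V) (s : Set V) (x y : V) : Prop :=
  ∃ p : G.Walk x y, ∀ v ∈ p.support, v ∈ s

/-- The connected component of `x` in the subgraph of `G` induced by `s`. -/
def compIn (G : SimpleGraph V) (s : Set V) (x : V) : Set V := {y | ReachIn G s x y}

/-- The set of connected components of the subgraph of `G` induced by `s`. -/
def comps (G : SimpleGraph V) (s : Set V) : Set (Set V) := {c | ∃ x ∈ s, c = compIn G s x}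

/-- `s` induces a (nonempty) connected subgraph of `G`. -/
def ConnIn (G : SimpleGraph V) (s : Set V) : Prop :=
  s.Nonempty ∧ ∀ x ∈ s, ∀ y ∈ s, ReachIn G s x y

/-- The total weight of a set of vertices. -/
noncomputable def wsum (w : V → ℝ) (s : Set V) : ℝ := ∑ᶠ x ∈ s, w x

/-- `IsSearchTree G s T`: `T` is a search tree on the subgraph of `G` induced by `s`.
Its root `r` is a vertex of `s`, its vertex set is `s`, and the subtrees rooted at the
children of `r` are search trees on the connected components of the induced subgraph
on `s \ {r}` (one subtree for each component). -/
inductive IsSearchTree (G : SimpleGraph V) : Set V → RTree V → Prop where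
  | node {s : Set V} {r : V} {ts : List (RTree V)} :
      r ∈ s →
      (RTree.node r ts).vertSet = s →
      (∀ t ∈ ts, IsSearchTree G (compIn G (s \ {r}) t.root) t) →
      ts.Pairwise (fun t₁ t₂ => compIn G (s \ {r}) t₁.root ≠ compIn G (s \ {r}) t₂.root) →
      IsSearchTree G s (RTree.node r ts)

/-- The cost of a search tree: `∑_x w(x) · depth(x)`, the root having depth 1. -/
noncomputable def cost (w : V → ℝ) (T : RTree V) : ℝ :=
  ∑ᶠ v ∈ T.vertSet, w v * (T.depth v : ℝ)

/-- The optimum cost of a search tree on the subgraph of `G` induced by `s`. -/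
noncomputable def OPT (G : SimpleGraph V) (w : V → ℝ) (s : Set V) : ℝ :=
  sInf (cost w '' {T | IsSearchTree G s T})

/-- `v` is an `α`-centroid of the subgraph of `G` induced by `s` (with weights `w`):
every connected component of the induced subgraph on `s \ {v}` has weight at most
`α` times the weight of `s`. -/
def IsAlphaCentroid (G : SimpleGraph V) (w : V → ℝ) (α : ℝ) (s : Set V) (v : V) : Prop :=
  v ∈ s ∧ ∀ x ∈ s \ {v}, wsum w (compIn G (s \ {v}) x) ≤ α * wsum w s

/-- `v` is a centroid of the subgraph of `G` induced by `s` (with weights `w`). -/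
def IsCentroid (G : SimpleGraph V) (w : V → ℝ) (s : Set V) (v : V) : Prop :=
  v ∈ s ∧ ∀ x ∈ s \ {v}, wsum w (compIn G (s \ {v}) x) ≤ wsum w s / 2

/-- `T` is an `α`-centroid tree on the subgraph of `G` induced by `s`. -/
def IsAlphaCentroidTree (G : SimpleGraph V) (w : V → ℝ) (α : ℝ) (s : Set V) (T : RTree V) :
    Prop :=
  IsSearchTree G s T ∧ ∀ t ∈ T.allSubtrees, IsAlphaCentroid G w α t.vertSet t.root

/-- `T` is a centroid tree on the subgraph of `G` induced by `s`. -/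
def IsCentroidTree (G : SimpleGraph V) (w : V → ℝ) (s : Set V) (T : RTree V) : Prop :=
  IsSearchTree G s T ∧ ∀ t ∈ T.allSubtrees, IsCentroid G w t.vertSet t.root

/-- `cent(𝒯,w)`: the maximum cost of a centroid tree. -/
noncomputable def centCost (G : SimpleGraph V) (w : V → ℝ) (s : Set V) : ℝ :=
  sSup (cost w '' {T | IsCentroidTree G w s T})

/-- `centᵅ(𝒯,w)`: the maximum cost of an `α`-centroid tree (`0` if none exists, since
`sSup ∅ = 0` in `ℝ`). -/
noncomputable def centCostA (G : SimpleGraph V) (w : V → ℝ) (α : ℝ) (s : Set V) : ℝ :=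
  sSup (cost w '' {T | IsAlphaCentroidTree G w α s T})

/-- `b` is a child of `a` in the rooted tree `T`. -/
def ChildRel (T : RTree V) (a b : V) : Prop :=
  ∃ t ∈ T.allSubtrees, t.root = a ∧ ∃ t' ∈ t.children, t'.root = b

namespace RTree

theorem mem_vertSet_node {r v : V} {ts : List (RTree V)} :
    v ∈ (node r ts).vertSet ↔ v = r ∨ ∃ t ∈ ts, v ∈ t.vertSet := by
  simp only [vertSet, pathsFrom, Set.mem_ofPred_eq, List.mem_cons, List.mem_flatten, List.mem_map,
    List.mem_attach, true_and, Subtype.exists]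
  constructor
  · rintro ⟨p, rfl | ⟨_, ⟨t, ht, rfl⟩, hp⟩, rfl⟩
    · exact .inl rfl
    · obtain ⟨q, hq, rfl⟩ := List.mem_map.1 hp
      exact .inr ⟨t, ht, q, hq, rfl⟩
  · rintro (rfl | ⟨t, ht, q, hq, rfl⟩)
    · exact ⟨_, .inl rfl, rfl⟩
    · exact ⟨_, .inr ⟨_, ⟨t, ht, rfl⟩, List.mem_map.2 ⟨q, hq, rfl⟩⟩, rfl⟩

theorem mem_pathSet_node {r v x : V} {ts : List (RTree V)} :
    x ∈ (node r ts).pathSet v ↔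
      (v = r ∧ x = r) ∨ ∃ t ∈ ts, v ∈ t.vertSet ∧ (x = r ∨ x ∈ t.pathSet v) := by
  simp only [vertSet, pathSet, pathsFrom, Set.mem_ofPred_eq, List.mem_cons, List.mem_flatten,
    List.mem_map, List.mem_attach, true_and, Subtype.exists]
  constructor
  · rintro ⟨p, rfl | ⟨_, ⟨t, ht, rfl⟩, hp⟩, rfl, hx⟩
    · exact .inl ⟨rfl, List.mem_singleton.1 hx⟩
    · obtain ⟨q, hq, rfl⟩ := List.mem_map.1 hp
      exact .inr ⟨t, ht, ⟨q, hq, rfl⟩, (List.mem_cons.1 hx).imp_right fun h => ⟨q, hq, rfl, h⟩⟩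
  · rintro (⟨rfl, rfl⟩ | ⟨t, ht, ⟨q, hq, rfl⟩, rfl | ⟨q', hq', hqq, hx⟩⟩)
    · exact ⟨_, .inl rfl, rfl, List.mem_singleton_self _⟩
    · exact ⟨_, .inr ⟨_, ⟨t, ht, rfl⟩, List.mem_map.2 ⟨q, hq, rfl⟩⟩, rfl, List.mem_cons_self⟩
    · exact ⟨_, .inr ⟨_, ⟨t, ht, rfl⟩, List.mem_map.2 ⟨q', hq', rfl⟩⟩, hqq,
        List.mem_cons_of_mem _ hx⟩

theorem mem_vertSet_of_mem_pathSet {T : RTree V} {v x : V} (h : x ∈ T.pathSet v) :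
    v ∈ T.vertSet :=
  let ⟨p, hp, hv, _⟩ := h
  ⟨p, hp, hv⟩

end RTree

namespace ReachIn

variable {G : SimpleGraph V} {s t : Set V} {x y z : V}

theorem symm (h : ReachIn G s x y) : ReachIn G s y x :=
  let ⟨p, hp⟩ := h
  ⟨p.reverse, fun v hv => hp v (by simpa using hv)⟩

theorem trans (h₁ : ReachIn G s x y) (h₂ : ReachIn G s y z) : ReachIn G s x z := by
  obtain ⟨p, hp⟩ := h₁
  obtain ⟨q, hq⟩ := h₂
  exact ⟨p.append q, fun v hv =>
    ((SimpleGraph.Walk.mem_support_append_iff p q).1 hv).elim (hp v) (hq v)⟩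

theorem mono (hst : s ⊆ t) (h : ReachIn G s x y) : ReachIn G t x y :=
  let ⟨p, hp⟩ := h
  ⟨p, fun v hv => hst (hp v hv)⟩

theorem right_mem (h : ReachIn G s x y) : y ∈ s :=
  let ⟨p, hp⟩ := h
  hp y p.end_mem_support

theorem inter (hG : G.IsAcyclic) (hs : ReachIn G s x y) (ht : ReachIn G t x y) :
    ReachIn G (s ∩ t) x y := by
  classical
  obtain ⟨p, hp⟩ := hs
  obtain ⟨q, hq⟩ := ht
  have h : p.bypass = q.bypass :=
    congrArg Subtype.val ((hG.subsingleton_path x y).elim ⟨_, p.bypass_isPath⟩ ⟨_, q.bypass_isPath⟩)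
  exact ⟨p.bypass, fun v hv =>
    ⟨hp v (p.support_bypass_subset_support hv), hq v (q.support_bypass_subset_support (h ▸ hv))⟩⟩

theorem compIn_eq (h : ReachIn G s x y) : compIn G s x = compIn G s y :=
  Set.ext fun _ => ⟨h.symm.trans, h.trans⟩

/-- The walk witnessing reachability in `s` stays in the component of its start. -/
theorem reachIn_compIn (h : ReachIn G s x y) : ReachIn G (compIn G s x) x y := by
  classical
  obtain ⟨p, hp⟩ := h
  exact ⟨p, fun v hv => ⟨p.takeUntil v hv, fun w hw =>
    hp w (p.support_takeUntil_subset_support hv hw)⟩⟩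

end ReachIn

namespace IsSearchTree

variable {G : SimpleGraph V} {s : Set V} {T : RTree V}

theorem vertSet_eq (h : IsSearchTree G s T) : T.vertSet = s := by
  cases h
  assumption

theorem root_mem (h : IsSearchTree G s T) : T.root ∈ s := by
  cases h
  assumption

theorem pathSet_subset (h : IsSearchTree G s T) (v : V) : T.pathSet v ⊆ s := by
  induction h with
  | node hr _ _ _ ih =>
    intro x hx
    rcases RTree.mem_pathSet_node.1 hx with ⟨-, rfl⟩ | ⟨t, ht, -, rfl | hx⟩
    · exact hr
    · exact hr
    · exact (ih t ht hx).right_mem.1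

theorem eq_of_reachIn {ts : List (RTree V)}
    (hp : ts.Pairwise fun t₁ t₂ => compIn G s t₁.root ≠ compIn G s t₂.root)
    {t₁ t₂ : RTree V} (h₁ : t₁ ∈ ts) (h₂ : t₂ ∈ ts) {x : V}
    (hx₁ : ReachIn G s t₁.root x) (hx₂ : ReachIn G s t₂.root x) : t₁ = t₂ := by
  by_contra hne
  have : Std.Symm fun t₁ t₂ : RTree V => compIn G s t₁.root ≠ compIn G s t₂.root :=
    ⟨fun _ _ h => h.symm⟩
  exact hp.forall h₁ h₂ hne (hx₁.trans hx₂.symm).compIn_eq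

/-- In an acyclic graph, every search tree projects to every connected vertex subset. -/
theorem exists_projection (hG : G.IsAcyclic) (hT : IsSearchTree G s T) :
    ∀ h ⊆ s, ConnIn G h →
      ∃ T', IsSearchTree G h T' ∧ ∀ v ∈ h, T'.pathSet v = T.pathSet v ∩ h := by
  classical
  induction hT with
  | @node s r ts hr hv hts hp ih =>
  intro h hhs hc
  have hmem : ∀ x ∈ s, x = r ∨ ∃ t ∈ ts, ReachIn G (s \ {r}) t.root x := by
    intro x hx
    rw [← hv, RTree.mem_vertSet_node] at hx
    refine hx.imp_right ?_
    rintro ⟨t, ht, hx⟩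
    rw [(hts t ht).vertSet_eq] at hx
    exact ⟨t, ht, hx⟩
  by_cases hrh : r ∈ h
  · have key : ∀ t : RTree V, ∃ u : RTree V, t ∈ ts → (h ∩ compIn G (s \ {r}) t.root).Nonempty →
        IsSearchTree G (h ∩ compIn G (s \ {r}) t.root) u ∧
          ∀ v ∈ h ∩ compIn G (s \ {r}) t.root,
            u.pathSet v = t.pathSet v ∩ (h ∩ compIn G (s \ {r}) t.root) := by
      intro t
      by_cases ht : t ∈ ts ∧ (h ∩ compIn G (s \ {r}) t.root).Nonempty
      · obtain ⟨u, hu⟩ := ih t ht.1 _ Set.inter_subset_right ⟨ht.2, fun x hx y hy =>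
          (hc.2 x hx.1 y hy.1).inter hG
            (hx.2.compIn_eq ▸ (hx.2.symm.trans hy.2).reachIn_compIn)⟩
        exact ⟨u, fun _ _ => hu⟩
      · exact ⟨t, fun h₁ h₂ => (ht ⟨h₁, h₂⟩).elim⟩
    choose f hf using key
    set us := (ts.filter fun t => (h ∩ compIn G (s \ {r}) t.root).Nonempty).map f with hus
    have mem_us : ∀ u, u ∈ us ↔
        ∃ t ∈ ts, (h ∩ compIn G (s \ {r}) t.root).Nonempty ∧ f t = u := by
      simp [hus, and_assoc]
    have comp_eq : ∀ t ∈ ts, (h ∩ compIn G (s \ {r}) t.root).Nonempty →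
        compIn G (h \ {r}) (f t).root = h ∩ compIn G (s \ {r}) t.root := by
      intro t ht hne
      have hroot := (hf t ht hne).1.root_mem
      ext y
      constructor
      · intro hy
        exact ⟨hy.right_mem.1,
          ReachIn.trans hroot.2 (hy.mono (Set.sdiff_subset_sdiff_left hhs))⟩
      · intro hy
        exact ((hc.2 _ hroot.1 y hy.1).inter hG (hroot.2.symm.trans hy.2)).mono
          fun z hz => ⟨hz.1, hz.2.2⟩
    refine ⟨.node r us, .node hrh ?_ ?_ ?_, ?_⟩
    · ext x
      rw [RTree.mem_vertSet_node]
      constructor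
      · rintro (rfl | ⟨u, hu, hx⟩)
        · exact hrh
        · obtain ⟨t, ht, hne, rfl⟩ := (mem_us u).1 hu
          rw [(hf t ht hne).1.vertSet_eq] at hx
          exact hx.1
      · intro hx
        refine (hmem x (hhs hx)).imp_right ?_
        rintro ⟨t, ht, hxt⟩
        have hne : (h ∩ compIn G (s \ {r}) t.root).Nonempty := ⟨x, hx, hxt⟩
        refine ⟨f t, (mem_us _).2 ⟨t, ht, hne, rfl⟩, ?_⟩
        rw [(hf t ht hne).1.vertSet_eq]
        exact ⟨hx, hxt⟩
    · intro u hu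
      obtain ⟨t, ht, hne, rfl⟩ := (mem_us u).1 hu
      rw [comp_eq t ht hne]
      exact (hf t ht hne).1
    · rw [hus, List.pairwise_map]
      refine (hp.filter _).imp_of_mem ?_
      intro t₁ t₂ h₁ h₂ hne heq
      simp only [List.mem_filter, decide_eq_true_eq] at h₁ h₂
      rw [comp_eq t₁ h₁.1 h₁.2, comp_eq t₂ h₂.1 h₂.2] at heq
      obtain ⟨x, hx⟩ := h₁.2
      have hx₂ : x ∈ h ∩ compIn G (s \ {r}) t₂.root := heq ▸ hx
      exact hne (ReachIn.trans hx.2 hx₂.2.symm).compIn_eq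
    · intro v hvh
      ext x
      rw [Set.mem_inter_iff, RTree.mem_pathSet_node, RTree.mem_pathSet_node]
      constructor
      · rintro (⟨rfl, rfl⟩ | ⟨u, hu, hvu, hx⟩)
        · exact ⟨.inl ⟨rfl, rfl⟩, hvh⟩
        · obtain ⟨t, ht, hne, rfl⟩ := (mem_us u).1 hu
          rw [(hf t ht hne).1.vertSet_eq] at hvu
          rw [(hf t ht hne).2 v hvu] at hx
          refine ⟨.inr ⟨t, ht, (hts t ht).vertSet_eq ▸ hvu.2, hx.imp_right And.left⟩, ?_⟩
          rcases hx with rfl | hx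
          · exact hrh
          · exact hx.2.1
      · rintro ⟨⟨rfl, rfl⟩ | ⟨t, ht, hvt, hx⟩, hxh⟩
        · exact .inl ⟨rfl, rfl⟩
        · rw [(hts t ht).vertSet_eq] at hvt
          have hne : (h ∩ compIn G (s \ {r}) t.root).Nonempty := ⟨v, hvh, hvt⟩
          refine .inr ⟨f t, (mem_us _).2 ⟨t, ht, hne, rfl⟩, ?_, ?_⟩
          · rw [(hf t ht hne).1.vertSet_eq]
            exact ⟨hvh, hvt⟩
          · rw [(hf t ht hne).2 v ⟨hvh, hvt⟩]
            exact hx.imp_right fun hx => ⟨hx, hxh, (hts t ht).pathSet_subset v hx⟩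
  · have hsub : h ⊆ s \ {r} := fun x hx => ⟨hhs hx, fun hxr => hrh (hxr ▸ hx)⟩
    obtain ⟨x₀, hx₀⟩ := hc.1
    obtain ⟨t, ht, hxt⟩ := (hmem x₀ (hhs hx₀)).resolve_left (hsub hx₀).2
    have hht : h ⊆ compIn G (s \ {r}) t.root := fun y hy =>
      hxt.trans ((hc.2 x₀ hx₀ y hy).mono hsub)
    obtain ⟨T', hT', hpath⟩ := ih t ht h hht hc
    refine ⟨T', hT', fun v hvh => ?_⟩
    rw [hpath v hvh]
    ext x
    rw [Set.mem_inter_iff, Set.mem_inter_iff, RTree.mem_pathSet_node]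
    refine and_congr_left fun hxh => ⟨fun hx => ?_, ?_⟩
    · exact .inr ⟨t, ht, RTree.mem_vertSet_of_mem_pathSet hx, .inr hx⟩
    · rintro (⟨-, rfl⟩ | ⟨t', ht', hvt', rfl | hx⟩)
      · exact (hrh hxh).elim
      · exact (hrh hxh).elim
      · rw [(hts t' ht').vertSet_eq] at hvt'
        exact eq_of_reachIn hp ht' ht hvt' (hht hvh) ▸ hx

theorem pathSet_eq_empty (hT : IsSearchTree G s T) {v : V} (hv : v ∉ s) : T.pathSet v = ∅ :=
  Set.eq_empty_of_forall_notMem fun _ hx =>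
    hv (hT.vertSet_eq ▸ RTree.mem_vertSet_of_mem_pathSet hx)

end IsSearchTree

theorem projection_exists_unique {V : Type} [Fintype V]
    (G : SimpleGraph V) (hG : G.IsTree)
    (T : RTree V) (hT : IsSearchTree G Set.univ T)
    (s : Set V) (hs : ConnIn G s) :
    ∃ T' : RTree V,
      (IsSearchTree G s T' ∧ ∀ v ∈ s, T'.pathSet v = T.pathSet v ∩ s) ∧
      ∀ T'' : RTree V,
        (IsSearchTree G s T'' ∧ ∀ v ∈ s, T''.pathSet v = T.pathSet v ∩ s) →
          RTree.Equiv T'' T' := by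
  obtain ⟨T', hT', hpath⟩ := hT.exists_projection hG.isAcyclic s (Set.subset_univ s) hs
  refine ⟨T', ⟨hT', hpath⟩, ?_⟩
  rintro T'' ⟨hT'', hpath''⟩ v
  by_cases hv : v ∈ s
  · rw [hpath v hv, hpath'' v hv]
  · rw [hT'.pathSet_eq_empty hv, hT''.pathSet_eq_empty hv]
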